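/- There is no groupoid (A;+) with a tolerance τ on it whose tolerance quotient (A;+)/τ is isomorphic, as a multi-groupoid, to the multi-groupoid (M;+) where M = {1,2,3} and a + b = {a,b} for all a,b ∈ M. -/

import Mathlib

/-- `B` is a clique of the binary relation `τ`: any two elements of `B` are related. -/
def IsClique {A : Type*} (τ : A → A → Prop) (B : Set A) : Prop :=
  ∀ a ∈ B, ∀ b ∈ B, τ a b

/-- `B` is a maximal clique (tolerance block) of `τ`. -/
def IsMaxClique {A : Type*} (τ : A → A → Prop) (B : Set A) : Prop :=
  IsClique τ B ∧ ∀ C : Set A, IsClique τ C → B ⊆ C → B = C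

/-- The multi-operation of the multi-groupoid `(M; +)` on the 3-element set `M`:
`a + b = {a, b}`. -/
def mAdd (a b : Fin 3) : Set (Fin 3) := {a, b}

/-- Every clique is contained in a maximal clique. -/
theorem IsClique.exists_isMaxClique {A : Type*} {τ : A → A → Prop} {C : Set A}
    (hC : IsClique τ C) : ∃ B, IsMaxClique τ B ∧ C ⊆ B := by
  obtain ⟨B, hCB, hB⟩ := zorn_subset_nonempty {D : Set A | IsClique τ D} (by
    intro c hc hchain _
    refine ⟨⋃₀ c, ?_, fun s hs => Set.subset_sUnion_of_mem hs⟩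
    rintro a ⟨s, hs, has⟩ b ⟨t, ht, hbt⟩
    rcases hchain.total hs ht with h | h
    · exact hc ht a (h has) b hbt
    · exact hc hs a has b (h hbt)) C hC
  exact ⟨B, ⟨hB.prop, fun D hD hBD => hBD.antisymm (hB.le_of_ge hD hBD)⟩, hCB⟩

/-- There is no groupoid `(A; +)` with a tolerance `τ` whose tolerance quotient
`(A; +)/τ` (the multi-groupoid on the tolerance blocks of `τ`, with
`B₁ + B₂ = {B : block | b₁ + b₂ ∈ B for all b₁ ∈ B₁, b₂ ∈ B₂}`) is isomorphic to the
multi-groupoid on `M = {1,2,3}` given by `a + b = {a, b}`. -/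
theorem no_tolerance_quotient_iso : ∀ (A : Type*) [Nonempty A]
    (add : A → A → A) (τ : A → A → Prop),
    (∀ a : A, τ a a) → (∀ a b : A, τ a b → τ b a) →
    (∀ a a' b b' : A, τ a a' → τ b b' → τ (add a b) (add a' b')) →
    ¬ ∃ φ : {B : Set A // IsMaxClique τ B} → Fin 3, Function.Bijective φ ∧
      ∀ B₁ B₂ : {B : Set A // IsMaxClique τ B},
        φ '' {B : {B : Set A // IsMaxClique τ B} |
            ∀ b₁ ∈ B₁.1, ∀ b₂ ∈ B₂.1, add b₁ b₂ ∈ B.1}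
          = mAdd (φ B₁) (φ B₂) := by
  rintro A _ add τ hrefl hsymm - ⟨φ, hφ, hadd⟩
  have key : ∀ X Y Z : {B : Set A // IsMaxClique τ B}, φ Z ≠ φ X → φ Z ≠ φ Y →
      ∃ p, p ∈ X.1 ∧ p ∈ Y.1 ∧ p ∉ Z.1 := by
    intro X Y Z hZX hZY
    have mem_iff : ∀ W : {B : Set A // IsMaxClique τ B},
        (∀ x ∈ X.1, ∀ y ∈ Y.1, add x y ∈ W.1) ↔ φ W = φ X ∨ φ W = φ Y := by
      intro W
      have h : φ W ∈ mAdd (φ X) (φ Y) ↔ φ W = φ X ∨ φ W = φ Y := Iff.rfl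
      rw [← h, ← hadd X Y, hφ.injective.mem_set_image, Set.mem_ofPred_eq]
    have hZ := mt (mem_iff Z).1 (not_or.2 ⟨hZX, hZY⟩)
    push Not at hZ
    obtain ⟨x, hx, y, hy, hxy⟩ := hZ
    exact ⟨add x y, (mem_iff X).2 (Or.inl rfl) x hx y hy,
      (mem_iff Y).2 (Or.inr rfl) x hx y hy, hxy⟩
  obtain ⟨X, hX⟩ := hφ.surjective 0
  obtain ⟨Y, hY⟩ := hφ.surjective 1
  obtain ⟨Z, hZ⟩ := hφ.surjective 2
  obtain ⟨p, hpX, hpY, hpZ⟩ := key X Y Z (by simp [hX, hZ]) (by simp [hY, hZ])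
  obtain ⟨q, hqX, hqZ, hqY⟩ := key X Z Y (by simp [hX, hY]) (by simp [hY, hZ])
  obtain ⟨r, hrY, hrZ, hrX⟩ := key Y Z X (by simp [hX, hY]) (by simp [hX, hZ])
  have hpq : τ p q := X.2.1 p hpX q hqX
  have hpr : τ p r := Y.2.1 p hpY r hrY
  have hqr : τ q r := Z.2.1 q hqZ r hrZ
  have hclique : IsClique τ {p, q, r} := by
    rintro a (rfl | rfl | rfl) b (rfl | rfl | rfl)
    all_goals first
      | exact hrefl _
      | assumption
      | exact hsymm _ _ (by assumption)
  obtain ⟨W, hW, hsub⟩ := hclique.exists_isMaxClique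
  have hcases : ∀ i : Fin 3, i = 0 ∨ i = 1 ∨ i = 2 := by decide
  rcases hcases (φ ⟨W, hW⟩) with h | h | h
  · obtain rfl := hφ.injective (h.trans hX.symm)
    exact hrX (hsub (by simp))
  · obtain rfl := hφ.injective (h.trans hY.symm)
    exact hqY (hsub (by simp))
  · obtain rfl := hφ.injective (h.trans hZ.symm)
    exact hpZ (hsub (by simp))
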